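/- Let n ≥ 2, let ω : [0,1] → ℝ and g : [0,1]² → ℝ be continuous, let σ² ≥ 0 be a real number, and let 𝓜 be a (nonnegative) measure on ℝ∖{0} such that the functions u ↦ e^{ju}(e^u−1)² are 𝓜-integrable for all integers 0 ≤ j ≤ n−2. Define d(m) = σ² + ∫_{ℝ∖{0}} e^{(m−1)u}(e^u−1)² d𝓜(u) for 1 ≤ m ≤ n−1. Then n! · ∫_{0<s₁<⋯<s_n<1} e^{ω(s₁)+⋯+ω(s_n)} [ Σ_{1≤k<p≤n} d(p−k) g(s_k, s_p) ] ds₁⋯ds_n = σ² n(n−1) (∫₀¹ e^{ω(s)} ds)^{n−2} ∫_{0<s₁<s₂<1} e^{ω(s₁)+ω(s₂)} g(s₁,s₂) ds₁ds₂ + Σ_{k=2}^{n} (n!/(n−k)!) · (∫_{ℝ∖{0}} (e^u−1)^k d𝓜(u)) · (∫₀¹ e^{ω(s)} ds)^{n−k} · ∫_{0<s₁<⋯<s_k<1} e^{ω(s₁)+⋯+ω(s_k)} g(s₁,s_k) ds₁⋯ds_k. -/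

import Mathlib

open MeasureTheory Real

/-- The open ordered simplex `{0 < s 0 < s 1 < ⋯ < s (k-1) < 1}` in `Fin k → ℝ`. -/
def orderedSimplex (k : ℕ) : Set (Fin k → ℝ) :=
  {s | StrictMono s ∧ ∀ i, s i ∈ Set.Ioo (0 : ℝ) 1}

/-- An injection `φ : α → γ` extends to an equivalence `α ⊕ β ≃ γ` in `(card β)!` ways. -/
lemma card_equiv_extending_injection {α β γ : Type*} [Fintype α] [Fintype β] [Fintype γ]
    [DecidableEq α] [DecidableEq β] [DecidableEq γ]
    (hcard : Fintype.card γ = Fintype.card α + Fintype.card β) {φ : α → γ}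
    (hφ : Function.Injective φ) :
    (Finset.univ.filter fun e : α ⊕ β ≃ γ => ⇑e ∘ Sum.inl = φ).card =
      (Fintype.card β).factorial := by
  classical
  let e₀ : Set.range (Sum.inl : α → α ⊕ β) ≃ Set.range φ :=
    (Equiv.ofInjective _ Sum.inl_injective).symm.trans (Equiv.ofInjective φ hφ)
  have he₀ : ∀ x : α, (e₀ ⟨Sum.inl x, x, rfl⟩ : γ) = φ x := by
    intro x
    have : (Equiv.ofInjective _ (Sum.inl_injective (α := α) (β := β))).symm
        ⟨Sum.inl x, x, rfl⟩ = x := by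
      rw [Equiv.symm_apply_eq]; rfl
    simp only [e₀, Equiv.trans_apply, this, Equiv.ofInjective_apply]
  have hs : Fintype.card ((Set.range (Sum.inl : α → α ⊕ β))ᶜ : Set (α ⊕ β)) =
      Fintype.card β := by
    rw [Fintype.card_compl_set, Set.card_range_of_injective Sum.inl_injective, Fintype.card_sum,
      Nat.add_sub_cancel_left]
  have ht : Fintype.card ((Set.range φ)ᶜ : Set γ) = Fintype.card β := by
    rw [Fintype.card_compl_set, Set.card_range_of_injective hφ, hcard, Nat.add_sub_cancel_left]
  rw [← hs, ← Fintype.card_equiv (Fintype.equivOfCardEq (hs.trans ht.symm)),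
    ← Fintype.card_congr (Equiv.Set.compl e₀), Fintype.card_subtype]
  congr 1
  ext e
  simp only [Finset.mem_filter, Finset.mem_univ, true_and, Subtype.forall, Set.mem_range,
    forall_exists_index, funext_iff, Function.comp_apply]
  constructor
  · rintro h _ x rfl
    rw [h x, he₀]
  · intro h x
    rw [h _ x rfl, he₀]

/-- Strictly increasing sequences of length `i + 2` with prescribed endpoints `a < b` are
determined by the choice of their `i` interior values. -/
lemma card_strictMono_with_endpoints {n : ℕ} (i : ℕ) {a b : Fin n} (hab : a < b) :
    (Finset.univ.filter fun φ : Fin (i + 2) → Fin n =>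
        StrictMono φ ∧ φ 0 = a ∧ φ (Fin.last (i + 1)) = b).card =
      ((b : ℕ) - (a : ℕ) - 1).choose i := by
  classical
  rw [← Fin.card_Ioo, ← Finset.card_powersetCard]
  have hlast : ∀ x : Fin (i + 2), x ≤ Fin.last (i + 1) := Fin.le_last
  refine Finset.card_bij (fun φ _ => (Finset.univ.image φ \ {a, b})) ?_ ?_ ?_
  · intro φ hφ
    obtain ⟨hm, h0, h1⟩ := (Finset.mem_filter.1 hφ).2
    rw [Finset.mem_powersetCard]
    constructor
    · intro x hx
      simp only [Finset.mem_sdiff, Finset.mem_image, Finset.mem_univ, true_and,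
        Finset.mem_insert, Finset.mem_singleton, not_or] at hx
      obtain ⟨⟨y, rfl⟩, hya, hyb⟩ := hx
      rw [Finset.mem_Ioo]
      exact ⟨lt_of_le_of_ne (h0 ▸ hm.monotone (Fin.zero_le y)) (Ne.symm hya),
        lt_of_le_of_ne (h1 ▸ hm.monotone (hlast y)) hyb⟩
    · rw [Finset.card_sdiff_of_subset, Finset.card_image_of_injective _ hm.injective,
        Finset.card_pair hab.ne]
      · simp
      · intro x hx
        simp only [Finset.mem_insert, Finset.mem_singleton] at hx
        rcases hx with rfl | rfl
        · exact Finset.mem_image.2 ⟨0, Finset.mem_univ _, h0⟩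
        · exact Finset.mem_image.2 ⟨Fin.last _, Finset.mem_univ _, h1⟩
  · intro φ hφ ψ hψ h
    obtain ⟨hm, h0, h1⟩ := (Finset.mem_filter.1 hφ).2
    obtain ⟨hm', h0', h1'⟩ := (Finset.mem_filter.1 hψ).2
    rw [← hm.range_inj hm']
    have key : ∀ x, x ∈ Finset.univ.image φ ↔ x ∈ Finset.univ.image ψ := by
      intro x
      by_cases hxa : x = a
      · subst hxa
        exact iff_of_true (Finset.mem_image.2 ⟨0, Finset.mem_univ _, h0⟩)
          (Finset.mem_image.2 ⟨0, Finset.mem_univ _, h0'⟩)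
      by_cases hxb : x = b
      · subst hxb
        exact iff_of_true (Finset.mem_image.2 ⟨_, Finset.mem_univ _, h1⟩)
          (Finset.mem_image.2 ⟨_, Finset.mem_univ _, h1'⟩)
      have := Finset.ext_iff.1 h x
      simpa [hxa, hxb] using this
    ext x
    simpa using key x
  · intro T hT
    obtain ⟨hT, hc⟩ := Finset.mem_powersetCard.1 hT
    have haT : a ∉ T := fun h => lt_irrefl _ (Finset.mem_Ioo.1 (hT h)).1
    have hbT : b ∉ T := fun h => lt_irrefl _ (Finset.mem_Ioo.1 (hT h)).2
    set U := insert a (insert b T) with hU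
    have hUc : U.card = i + 2 := by
      rw [hU, Finset.card_insert_of_notMem, Finset.card_insert_of_notMem hbT, hc]
      simp [hab.ne, haT]
    have hmem : ∀ x ∈ U, a ≤ x ∧ x ≤ b := by
      intro x hx
      simp only [hU, Finset.mem_insert] at hx
      rcases hx with rfl | rfl | hx
      · exact ⟨le_rfl, hab.le⟩
      · exact ⟨hab.le, le_rfl⟩
      · exact ⟨(Finset.mem_Ioo.1 (hT hx)).1.le, (Finset.mem_Ioo.1 (hT hx)).2.le⟩
    have hsurj : ∀ x ∈ U, ∃ y, U.orderEmbOfFin hUc y = x := by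
      intro x hx
      have : x ∈ Set.range (U.orderEmbOfFin hUc) := by
        rw [Finset.range_orderEmbOfFin]; exact hx
      exact this
    refine ⟨U.orderEmbOfFin hUc, ?_, ?_⟩
    · refine Finset.mem_filter.2 ⟨Finset.mem_univ _, (U.orderEmbOfFin hUc).strictMono, ?_, ?_⟩
      · obtain ⟨y, hy⟩ := hsurj a (by simp [hU])
        refine le_antisymm ?_ (hmem _ (Finset.orderEmbOfFin_mem U hUc 0)).1
        exact hy ▸ (U.orderEmbOfFin hUc).monotone (Fin.zero_le y)
      · obtain ⟨y, hy⟩ := hsurj b (by simp [hU])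
        refine le_antisymm (hmem _ (Finset.orderEmbOfFin_mem U hUc _)).2 ?_
        exact hy ▸ (U.orderEmbOfFin hUc).monotone (hlast y)
    · rw [Finset.image_orderEmbOfFin_univ]
      ext x
      simp only [hU, Finset.mem_sdiff, Finset.mem_insert, Finset.mem_singleton, not_or]
      constructor
      · tauto
      · intro hx
        exact ⟨Or.inr (Or.inr hx), fun h => haT (h ▸ hx), fun h => hbT (h ▸ hx)⟩

open Classical in
/-- Summing over all ways to label `Fin n` by `Fin (i + 2) ⊕ Fin m` so that the first block is
increasing, a function of the endpoints of this block. -/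
lemma sum_equiv_endpoints {n i m : ℕ} (hn : n = i + 2 + m) (J : Fin n → Fin n → ℝ) :
    (∑ e : Fin (i + 2) ⊕ Fin m ≃ Fin n,
        if StrictMono (e ∘ Sum.inl) then
          J (e (Sum.inl 0)) (e (Sum.inl (Fin.last (i + 1)))) else 0) =
      ∑ b : Fin n, ∑ a : Fin n, if (a : ℕ) < (b : ℕ) then
        (m.factorial : ℝ) * (((b : ℕ) - (a : ℕ) - 1).choose i : ℝ) * J a b else 0 := by
  have h1 : (∑ e : Fin (i + 2) ⊕ Fin m ≃ Fin n,
        if StrictMono (e ∘ Sum.inl) then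
          J (e (Sum.inl 0)) (e (Sum.inl (Fin.last (i + 1)))) else 0) =
      ∑ φ : Fin (i + 2) → Fin n, if StrictMono φ then
        (m.factorial : ℝ) * J (φ 0) (φ (Fin.last (i + 1))) else 0 := by
    rw [← Finset.sum_fiberwise Finset.univ
      (fun e : Fin (i + 2) ⊕ Fin m ≃ Fin n => (⇑e ∘ Sum.inl : Fin (i + 2) → Fin n))]
    refine Finset.sum_congr rfl fun φ _ => ?_
    rw [Finset.sum_congr rfl (g := fun _ => if StrictMono φ then
      J (φ 0) (φ (Fin.last (i + 1))) else 0)]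
    · rw [Finset.sum_const, nsmul_eq_mul]
      split_ifs with hφ
      · rw [card_equiv_extending_injection (by simp [hn]) hφ.injective, Fintype.card_fin]
      · simp
    · intro e he
      rw [← (Finset.mem_filter.1 he).2]
      rfl
  rw [h1, ← Finset.sum_fiberwise Finset.univ (fun φ : Fin (i + 2) → Fin n => φ (Fin.last (i + 1)))]
  refine Finset.sum_congr rfl fun b _ => ?_
  rw [← Finset.sum_fiberwise _ (fun φ : Fin (i + 2) → Fin n => φ 0)]
  refine Finset.sum_congr rfl fun a _ => ?_
  rw [← Finset.sum_filter, Finset.filter_filter, Finset.filter_filter]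
  by_cases hab : a < b
  · rw [if_pos (Fin.lt_def.1 hab), ← card_strictMono_with_endpoints i hab,
      Finset.sum_congr rfl (g := fun _ => (m.factorial : ℝ) * J a b), Finset.sum_const,
      nsmul_eq_mul, ← mul_assoc, mul_comm (m.factorial : ℝ)]
    · congr 4
      ext φ
      simp only [Finset.mem_filter, Finset.mem_univ, true_and]
      tauto
    · intro φ hφ
      obtain ⟨h1, h0, -⟩ := (Finset.mem_filter.1 hφ).2
      rw [h0, h1]
  · rw [if_neg (fun h => hab (Fin.lt_def.2 h))]
    refine Finset.sum_eq_zero fun φ hφ => absurd ?_ hab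
    obtain ⟨h1, h0, hm⟩ := (Finset.mem_filter.1 hφ).2
    rw [← h0, ← h1]
    exact hm (Fin.last_pos)

lemma measurableSet_strictMono (k : ℕ) : MeasurableSet {s : Fin k → ℝ | StrictMono s} := by
  simp only [StrictMono, Set.ofPred_forall]
  refine MeasurableSet.iInter fun i => MeasurableSet.iInter fun j => MeasurableSet.iInter fun _ => ?_
  exact measurableSet_lt (measurable_pi_apply i) (measurable_pi_apply j)

lemma ae_injective_pi (ι : Type*) [Fintype ι] :
    ∀ᵐ t : ι → ℝ, Function.Injective t := by
  classical
  have h : ∀ i j : ι, i ≠ j → ∀ᵐ t : ι → ℝ, t i ≠ t j := by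
    intro i j hij
    let S : Submodule ℝ (ι → ℝ) :=
      LinearMap.ker ((LinearMap.proj i : (ι → ℝ) →ₗ[ℝ] ℝ) - LinearMap.proj j)
    have hS : S ≠ ⊤ := by
      intro h
      have : Pi.single i (1 : ℝ) ∈ S := h ▸ Submodule.mem_top
      simp [S, LinearMap.mem_ker, hij] at this
    have h0 := Measure.addHaar_submodule (volume : Measure (ι → ℝ)) S hS
    rw [ae_iff]
    convert! h0 using 2
    ext t
    simp [S, LinearMap.mem_ker, sub_eq_zero]
  have h' : ∀ᵐ t : ι → ℝ, ∀ i j : ι, i ≠ j → t i ≠ t j := by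
    rw [ae_all_iff]; intro i
    rw [ae_all_iff]; intro j
    by_cases hij : i = j
    · simp [hij]
    · filter_upwards [h i j hij] with t ht _ using ht
  filter_upwards [h'] with t ht i j hij
  by_contra hne
  exact ht i j hne hij

/-- An injective real family has a unique increasing rearrangement. -/
lemma existsUnique_equiv_strictMono {ι : Type*} [Fintype ι] {n : ℕ} (hn : Fintype.card ι = n)
    {t : ι → ℝ} (ht : Function.Injective t) :
    ∃! e : ι ≃ Fin n, StrictMono (t ∘ e.symm) := by
  classical
  let e₁ : ι ≃ Set.range t := Equiv.ofInjective t ht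
  have hc : Fintype.card (Set.range t) = n := by
    rw [← hn]; exact Fintype.card_congr e₁.symm
  let o := monoEquivOfFin (Set.range t) hc
  have hmono : StrictMono (t ∘ (e₁.trans o.symm.toEquiv).symm) := by
    have h : ∀ z, t ((e₁.trans o.symm.toEquiv).symm z) = (o z : ℝ) := by
      intro z
      change t (e₁.symm (o z)) = (o z : ℝ)
      conv_rhs => rw [← e₁.apply_symm_apply (o z)]
      rfl
    intro x y hxy
    simp only [Function.comp_apply, h]
    exact o.strictMono hxy
  refine ⟨e₁.trans o.symm.toEquiv, hmono, fun e he => ?_⟩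
  have hr : t ∘ e.symm = t ∘ (e₁.trans o.symm.toEquiv).symm := by
    rw [← he.range_inj hmono, Set.range_comp, Set.range_comp, Equiv.range_eq_univ,
      Equiv.range_eq_univ]
  exact Equiv.symm_bijective.injective (DFunLike.coe_injective (ht.comp_left hr))

open Classical in
/-- Integrating over all of `ℝ^ι` amounts to integrating over the increasing chamber after summing
over all labellings. -/
lemma integral_eq_sum_integral_strictMono {ι : Type*} [Fintype ι] [DecidableEq ι] {n : ℕ}
    (hn : Fintype.card ι = n) {H : (ι → ℝ) → ℝ} (hH : Integrable H) :
    ∫ t, H t = ∑ e : ι ≃ Fin n, ∫ s : Fin n → ℝ, if StrictMono s then H (s ∘ e) else 0 := by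
  have h1 : ∀ e : ι ≃ Fin n, (∫ s : Fin n → ℝ, if StrictMono s then H (s ∘ e) else 0) =
      ∫ t : ι → ℝ, if StrictMono (t ∘ e.symm) then H t else 0 := by
    intro e
    rw [← (volume_preserving_arrowCongr' e (MeasurableEquiv.refl ℝ)
      (MeasurePreserving.id volume)).integral_comp']
    refine integral_congr_ae (.of_forall fun t => ?_)
    have h2 : (MeasurableEquiv.arrowCongr' e (MeasurableEquiv.refl ℝ)) t = t ∘ e.symm := rfl
    simp only [h2, Function.comp_assoc, Equiv.symm_comp_self, Function.comp_id]
  simp only [h1]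
  rw [← integral_finsetSum]
  · refine integral_congr_ae ?_
    filter_upwards [ae_injective_pi ι] with t ht
    obtain ⟨e, he, hu⟩ := existsUnique_equiv_strictMono hn ht
    rw [Finset.sum_eq_single e]
    · rw [if_pos he]
    · intro e' _ hne
      exact if_neg fun h => hne (hu e' h)
    · simp
  · intro e _
    have : MeasurableSet {t : ι → ℝ | StrictMono (t ∘ e.symm)} :=
      (measurable_pi_lambda (fun (t : ι → ℝ) => t ∘ e.symm)
        fun i => measurable_pi_apply _) (measurableSet_strictMono n)
    exact (hH.indicator this).congr (.of_forall fun t => by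
      simp only [Set.indicator_apply, Set.mem_ofPred_eq])

open Classical in
/-- The integral over the increasing chamber of `∏ w (s x)` times `G` at two coordinates. -/
noncomputable def chamberIntegral (w : ℝ → ℝ) (G : ℝ × ℝ → ℝ) (n : ℕ) (a b : Fin n) : ℝ :=
  ∫ s : Fin n → ℝ, if StrictMono s then (∏ x, w (s x)) * G (s a, s b) else 0

lemma integrable_prod_mul_pair {ι : Type*} [Fintype ι] {w : ℝ → ℝ} (hw : Integrable w)
    {G : ℝ × ℝ → ℝ} (hG : Measurable G) {C : ℝ} (hC : ∀ p, ‖G p‖ ≤ C) (a b : ι) :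
    Integrable fun t : ι → ℝ => (∏ x, w (t x)) * G (t a, t b) := by
  have h : Integrable fun t : ι → ℝ => ∏ x, w (t x) :=
    Integrable.fintype_prod (f := fun _ => w) fun _ => hw
  refine h.mul_bdd (c := C) ?_ (.of_forall fun t => hC _)
  exact (hG.comp ((measurable_pi_apply a).prodMk (measurable_pi_apply b))).aestronglyMeasurable

/-- Shuffle identity: the product of an integral over an increasing chamber with a power of the
total mass, as a sum over increasing chambers in higher dimension. -/
lemma pow_mul_chamberIntegral {w : ℝ → ℝ} (hw : Integrable w) {G : ℝ × ℝ → ℝ}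
    (hG : Measurable G) {C : ℝ} (hC : ∀ p, ‖G p‖ ≤ C) {n i m : ℕ} (hn : n = i + 2 + m) :
    (∫ x, w x) ^ m * chamberIntegral w G (i + 2) 0 (Fin.last (i + 1)) =
      ∑ b : Fin n, ∑ a : Fin n, if (a : ℕ) < (b : ℕ) then
        (m.factorial : ℝ) * (((b : ℕ) - (a : ℕ) - 1).choose i : ℝ) *
          chamberIntegral w G n a b else 0 := by
  classical
  rw [← sum_equiv_endpoints hn]
  let H : (Fin (i + 2) ⊕ Fin m → ℝ) → ℝ := fun t =>
    if StrictMono (t ∘ Sum.inl) then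
      (∏ x, w (t x)) * G (t (Sum.inl 0), t (Sum.inl (Fin.last (i + 1)))) else 0
  have hH : Integrable H := by
    have : MeasurableSet {t : Fin (i + 2) ⊕ Fin m → ℝ | StrictMono (t ∘ Sum.inl)} :=
      (measurable_pi_lambda (fun (t : Fin (i + 2) ⊕ Fin m → ℝ) => t ∘ Sum.inl)
        fun i => measurable_pi_apply _) (measurableSet_strictMono _)
    refine ((integrable_prod_mul_pair hw hG hC (Sum.inl 0)
      (Sum.inl (Fin.last (i + 1)))).indicator this).congr (.of_forall fun t => ?_)
    simp only [H, Set.indicator_apply, Set.mem_ofPred_eq]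
  have hsplit : ∫ t, H t =
      (∫ x, w x) ^ m * chamberIntegral w G (i + 2) 0 (Fin.last (i + 1)) := by
    rw [← (volume_measurePreserving_sumPiEquivProdPi_symm
      (fun _ : Fin (i + 2) ⊕ Fin m => ℝ)).integral_comp']
    have h := integral_prod_mul (μ := (volume : Measure (Fin (i + 2) → ℝ)))
      (ν := (volume : Measure (Fin m → ℝ)))
      (fun s => if StrictMono s then (∏ x, w (s x)) * G (s 0, s (Fin.last (i + 1))) else 0)
      (fun s => ∏ x, w (s x))
    rw [integral_fintype_prod_volume_eq_pow, Fintype.card_fin] at h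
    rw [mul_comm]
    refine Eq.trans ?_ h
    refine integral_congr_ae (.of_forall fun p => ?_)
    have h1 : ∀ x, (MeasurableEquiv.sumPiEquivProdPi
      (fun _ : Fin (i + 2) ⊕ Fin m => ℝ)).symm p (Sum.inl x) = p.1 x := fun _ => rfl
    have h2 : ∀ x, (MeasurableEquiv.sumPiEquivProdPi
      (fun _ : Fin (i + 2) ⊕ Fin m => ℝ)).symm p (Sum.inr x) = p.2 x := fun _ => rfl
    have h3 : ((MeasurableEquiv.sumPiEquivProdPi
      (fun _ : Fin (i + 2) ⊕ Fin m => ℝ)).symm p) ∘ Sum.inl = p.1 := rfl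
    simp only [H, h1, h2, h3, Fintype.prod_sum_type]
    split_ifs
    · ring
    · simp
  rw [← hsplit, integral_eq_sum_integral_strictMono (n := n) (by simp [hn]) hH]
  refine Finset.sum_congr rfl fun e _ => ?_
  by_cases he : StrictMono (e ∘ Sum.inl)
  · rw [if_pos he, chamberIntegral]
    refine integral_congr_ae (.of_forall fun s => ?_)
    by_cases hs : StrictMono s
    · have h1 : StrictMono ((s ∘ e) ∘ Sum.inl) := hs.comp he
      simp only [H, if_pos hs, if_pos h1, Function.comp_apply]
      rw [e.prod_comp (fun x => w (s x))]
    · simp only [if_neg hs]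
  · rw [if_neg he]
    refine integral_eq_zero_of_ae (.of_forall fun s => ?_)
    by_cases hs : StrictMono s
    · have h1 : ¬ StrictMono ((s ∘ e) ∘ Sum.inl) := fun h => he fun x y hxy =>
        hs.lt_iff_lt.1 (h hxy)
      simp only [H, if_pos hs, if_neg h1, Pi.zero_apply]
    · simp only [if_neg hs, Pi.zero_apply]

lemma measurableSet_orderedSimplex (k : ℕ) : MeasurableSet (orderedSimplex k) := by
  have h : orderedSimplex k =
      {s : Fin k → ℝ | StrictMono s} ∩ ⋂ i, (fun s : Fin k → ℝ => s i) ⁻¹' Set.Ioo (0 : ℝ) 1 := by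
    ext s
    simp [orderedSimplex]
  rw [h]
  exact (measurableSet_strictMono k).inter
    (MeasurableSet.iInter fun i => measurable_pi_apply i measurableSet_Ioo)

open Classical in
lemma indicator_orderedSimplex (ω : ℝ → ℝ) (g : ℝ → ℝ → ℝ) {k : ℕ} (a b : Fin k) :
    (orderedSimplex k).indicator
        (fun s => Real.exp (∑ i, ω (s i)) * g (s a) (s b)) =
      fun s => if StrictMono s then
        (∏ x, (Set.Ioo (0 : ℝ) 1).indicator (fun x => Real.exp (ω x)) (s x)) *
          (Set.Ioo (0 : ℝ) 1 ×ˢ Set.Ioo (0 : ℝ) 1).indicator (fun p => g p.1 p.2) (s a, s b)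
        else 0 := by
  funext s
  by_cases hs : StrictMono s
  · rw [if_pos hs]
    by_cases h : ∀ i, s i ∈ Set.Ioo (0 : ℝ) 1
    · rw [Set.indicator_of_mem (show s ∈ orderedSimplex k from ⟨hs, h⟩),
        Set.indicator_of_mem (show (s a, s b) ∈ Set.Ioo (0 : ℝ) 1 ×ˢ Set.Ioo (0 : ℝ) 1 from
          ⟨h a, h b⟩), Real.exp_sum]
      congr 1
      exact Finset.prod_congr rfl fun i _ =>
        (Set.indicator_of_mem (h i) fun x => Real.exp (ω x)).symm
    · rw [Set.indicator_of_notMem (fun hm : s ∈ orderedSimplex k => h hm.2)]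
      push Not at h
      obtain ⟨i, hi⟩ := h
      rw [Finset.prod_eq_zero (Finset.mem_univ i) (Set.indicator_of_notMem hi _), zero_mul]
  · rw [if_neg hs, Set.indicator_of_notMem (fun hm : s ∈ orderedSimplex k => hs hm.1)]

lemma setIntegral_orderedSimplex (ω : ℝ → ℝ) (g : ℝ → ℝ → ℝ) {k : ℕ} (a b : Fin k) :
    ∫ s in orderedSimplex k, Real.exp (∑ i, ω (s i)) * g (s a) (s b) =
      chamberIntegral ((Set.Ioo (0 : ℝ) 1).indicator fun x => Real.exp (ω x))
        ((Set.Ioo (0 : ℝ) 1 ×ˢ Set.Ioo (0 : ℝ) 1).indicator fun p => g p.1 p.2) k a b := by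
  rw [← integral_indicator (measurableSet_orderedSimplex k), indicator_orderedSimplex,
    chamberIntegral]

lemma integrable_indicator_exp {ω : ℝ → ℝ} (hω : ContinuousOn ω (Set.Icc 0 1)) :
    Integrable ((Set.Ioo (0 : ℝ) 1).indicator fun x => Real.exp (ω x)) := by
  rw [integrable_indicator_iff measurableSet_Ioo]
  exact ((Real.continuous_exp.comp_continuousOn hω).integrableOn_Icc).mono_set
    Set.Ioo_subset_Icc_self

lemma measurable_indicator_square {g : ℝ → ℝ → ℝ}
    (hg : ContinuousOn (fun p : ℝ × ℝ => g p.1 p.2) (Set.Icc 0 1 ×ˢ Set.Icc 0 1)) :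
    Measurable ((Set.Ioo (0 : ℝ) 1 ×ˢ Set.Ioo (0 : ℝ) 1).indicator fun p => g p.1 p.2) := by
  classical
  rw [← Set.piecewise_eq_indicator]
  exact ContinuousOn.measurable_piecewise
    (hg.mono (Set.prod_mono Set.Ioo_subset_Icc_self Set.Ioo_subset_Icc_self))
    continuousOn_const (measurableSet_Ioo.prod measurableSet_Ioo)

lemma exists_bound_indicator_square {g : ℝ → ℝ → ℝ}
    (hg : ContinuousOn (fun p : ℝ × ℝ => g p.1 p.2) (Set.Icc 0 1 ×ˢ Set.Icc 0 1)) :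
    ∃ C, ∀ p, ‖(Set.Ioo (0 : ℝ) 1 ×ˢ Set.Ioo (0 : ℝ) 1).indicator
      (fun p => g p.1 p.2) p‖ ≤ C := by
  obtain ⟨C, hC⟩ := (isCompact_Icc.prod isCompact_Icc).exists_bound_of_continuousOn hg
  refine ⟨max C 0, fun p => ?_⟩
  by_cases hp : p ∈ Set.Ioo (0 : ℝ) 1 ×ˢ Set.Ioo (0 : ℝ) 1
  · rw [Set.indicator_of_mem hp]
    exact (hC p (Set.prod_mono Set.Ioo_subset_Icc_self Set.Ioo_subset_Icc_self hp)).trans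
      (le_max_left _ _)
  · rw [Set.indicator_of_notMem hp, norm_zero]
    exact le_max_right _ _

lemma integrableOn_orderedSimplex {ω : ℝ → ℝ} {g : ℝ → ℝ → ℝ}
    (hω : ContinuousOn ω (Set.Icc 0 1))
    (hg : ContinuousOn (fun p : ℝ × ℝ => g p.1 p.2) (Set.Icc 0 1 ×ˢ Set.Icc 0 1))
    {k : ℕ} (a b : Fin k) :
    IntegrableOn (fun s => Real.exp (∑ i, ω (s i)) * g (s a) (s b)) (orderedSimplex k) := by
  classical
  obtain ⟨C, hC⟩ := exists_bound_indicator_square hg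
  rw [← integrable_indicator_iff (measurableSet_orderedSimplex k), indicator_orderedSimplex]
  refine ((integrable_prod_mul_pair (integrable_indicator_exp hω) (measurable_indicator_square hg)
    hC a b).indicator (measurableSet_strictMono k)).congr (.of_forall fun s => ?_)
  simp only [Set.indicator_apply, Set.mem_ofPred_eq]

/-- Summing over all increasing `(i + 2)`-element selections from an `n`-fold ordered simplex. -/
lemma sum_choose_mul_setIntegral {ω : ℝ → ℝ} {g : ℝ → ℝ → ℝ}
    (hω : ContinuousOn ω (Set.Icc 0 1))
    (hg : ContinuousOn (fun p : ℝ × ℝ => g p.1 p.2) (Set.Icc 0 1 ×ˢ Set.Icc 0 1))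
    {n i : ℕ} (hi : i + 2 ≤ n) :
    (∑ p : Fin n, ∑ k : Fin n, if (k : ℕ) < (p : ℕ) then
        (((p : ℕ) - (k : ℕ) - 1).choose i : ℝ) *
          ∫ s in orderedSimplex n, Real.exp (∑ i, ω (s i)) * g (s k) (s p) else 0) =
      (∫ s in Set.Ioo (0 : ℝ) 1, Real.exp (ω s)) ^ (n - (i + 2)) *
        (∫ s in orderedSimplex (i + 2),
          Real.exp (∑ i, ω (s i)) * g (s 0) (s (Fin.last (i + 1)))) /
        ((n - (i + 2)).factorial : ℝ) := by
  obtain ⟨C, hC⟩ := exists_bound_indicator_square hg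
  have h := pow_mul_chamberIntegral (integrable_indicator_exp hω) (measurable_indicator_square hg)
    hC (Nat.add_sub_of_le hi).symm
  rw [integral_indicator measurableSet_Ioo] at h
  simp only [setIntegral_orderedSimplex]
  rw [h, eq_div_iff (by positivity), Finset.sum_mul]
  refine Finset.sum_congr rfl fun p _ => ?_
  rw [Finset.sum_mul]
  refine Finset.sum_congr rfl fun k _ => ?_
  split_ifs
  · ring
  · simp

lemma integrable_exp_sub_one_pow {M : Measure ℝ} {n : ℕ}
    (hint : ∀ j : ℕ, j ≤ n →
      Integrable (fun u => Real.exp (j * u) * (Real.exp u - 1) ^ 2) M)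
    {j : ℕ} (hj : j ≤ n) : Integrable (fun u => (Real.exp u - 1) ^ (j + 2)) M := by
  have h : (fun u => (Real.exp u - 1) ^ (j + 2)) = fun u => ∑ i ∈ Finset.range (j + 1),
      ((-1) ^ (j - i) * (j.choose i : ℝ)) * (Real.exp (i * u) * (Real.exp u - 1) ^ 2) := by
    funext u
    rw [pow_add, sub_eq_add_neg, add_pow, Finset.sum_mul]
    refine Finset.sum_congr rfl fun i _ => ?_
    rw [Real.exp_nat_mul]
    ring
  rw [h]
  exact integrable_finsetSum _ fun i hi =>
    (hint i ((Nat.lt_succ_iff.1 (Finset.mem_range.1 hi)).trans hj)).const_mul _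

/-- Binomial expansion of `e^{mu} = (1 + (e^u - 1))^m` under the integral sign. -/
lemma integral_exp_mul_eq_sum_choose {M : Measure ℝ} {n : ℕ}
    (hint : ∀ j : ℕ, j ≤ n →
      Integrable (fun u => Real.exp (j * u) * (Real.exp u - 1) ^ 2) M)
    {m : ℕ} (hm : m ≤ n) :
    ∫ u, Real.exp (m * u) * (Real.exp u - 1) ^ 2 ∂M =
      ∑ i ∈ Finset.range (n + 1), (m.choose i : ℝ) * ∫ u, (Real.exp u - 1) ^ (i + 2) ∂M := by
  have h : ∀ u : ℝ, Real.exp (m * u) * (Real.exp u - 1) ^ 2 =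
      ∑ i ∈ Finset.range (n + 1), (m.choose i : ℝ) * (Real.exp u - 1) ^ (i + 2) := by
    intro u
    have hsub : Finset.range (m + 1) ⊆ Finset.range (n + 1) :=
      Finset.range_subset_range.2 (by lia)
    rw [← Finset.sum_subset hsub, Real.exp_nat_mul]
    · conv_lhs => rw [← sub_add_cancel (Real.exp u) 1, add_pow, Finset.sum_mul]
      refine Finset.sum_congr rfl fun i _ => ?_
      simp only [one_pow, sub_add_cancel]
      ring
    · intro i _ hi
      rw [Nat.choose_eq_zero_of_lt (by simpa using hi)]
      simp
  simp only [h]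
  rw [integral_finsetSum]
  · simp only [integral_const_mul]
  · exact fun i hi => (integrable_exp_sub_one_pow hint
      (Nat.lt_succ_iff.1 (Finset.mem_range.1 hi))).const_mul _

/-- Equivalence of the two formulas for the intermittency derivative of the
`n`-th moment of the total mass: the formula obtained by differentiating the
generalized Selberg integral representation (LHS) and the formula given by the
intermittency differentiation rule (RHS).  Here `d m = σ² + ∫ e^{(m−1)u}(e^u−1)² d𝓜`
and the sum `Σ_{k=2}^n` is indexed by `k = j + 2` with `j ∈ range (n−1)`. -/
theorem moment_derivative_equivalence
    (n : ℕ) (hn : 2 ≤ n)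
    (ω : ℝ → ℝ) (g : ℝ → ℝ → ℝ)
    (hω : ContinuousOn ω (Set.Icc 0 1))
    (hg : ContinuousOn (fun p : ℝ × ℝ => g p.1 p.2) (Set.Icc 0 1 ×ˢ Set.Icc 0 1))
    (σsq : ℝ) (hσ : 0 ≤ σsq)
    (M : Measure ℝ) (hM0 : M {0} = 0)
    (hint : ∀ j : ℕ, j ≤ n - 2 →
      Integrable (fun u => Real.exp (j * u) * (Real.exp u - 1) ^ 2) M)
    (d : ℕ → ℝ)
    (hd : ∀ m : ℕ, 1 ≤ m → m ≤ n - 1 →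
      d m = σsq + ∫ u, Real.exp (((m - 1 : ℕ) : ℝ) * u) * (Real.exp u - 1) ^ 2 ∂M) :
    (n.factorial : ℝ) *
        (∫ s in orderedSimplex n,
          Real.exp (∑ i, ω (s i)) *
            ∑ p : Fin n, ∑ k : Fin n,
              if (k : ℕ) < (p : ℕ) then d ((p : ℕ) - (k : ℕ)) * g (s k) (s p) else 0) =
      σsq * n * (n - 1) * (∫ s in Set.Ioo (0 : ℝ) 1, Real.exp (ω s)) ^ (n - 2) *
          (∫ s in orderedSimplex 2, Real.exp (ω (s 0) + ω (s 1)) * g (s 0) (s 1)) +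
        ∑ j ∈ Finset.range (n - 1),
          ((n.factorial : ℝ) / ((n - (j + 2)).factorial : ℝ)) *
            (∫ u, (Real.exp u - 1) ^ (j + 2) ∂M) *
            (∫ s in Set.Ioo (0 : ℝ) 1, Real.exp (ω s)) ^ (n - (j + 2)) *
            ∫ s in orderedSimplex (j + 2),
              Real.exp (∑ i, ω (s i)) * g (s 0) (s (Fin.last (j + 1))) := by
  have hlhs : (∫ s in orderedSimplex n, Real.exp (∑ i, ω (s i)) *
      ∑ p : Fin n, ∑ k : Fin n,
        if (k : ℕ) < (p : ℕ) then d ((p : ℕ) - (k : ℕ)) * g (s k) (s p) else 0) =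
      ∑ p : Fin n, ∑ k : Fin n, if (k : ℕ) < (p : ℕ) then d ((p : ℕ) - (k : ℕ)) *
        ∫ s in orderedSimplex n, Real.exp (∑ i, ω (s i)) * g (s k) (s p) else 0 := by
    have hterm : ∀ s : Fin n → ℝ, Real.exp (∑ i, ω (s i)) *
        (∑ p : Fin n, ∑ k : Fin n,
          if (k : ℕ) < (p : ℕ) then d ((p : ℕ) - (k : ℕ)) * g (s k) (s p) else 0) =
        ∑ p : Fin n, ∑ k : Fin n, (if (k : ℕ) < (p : ℕ) then d ((p : ℕ) - (k : ℕ)) else 0) *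
          (Real.exp (∑ i, ω (s i)) * g (s k) (s p)) := by
      intro s
      simp only [Finset.mul_sum]
      refine Finset.sum_congr rfl fun p _ => Finset.sum_congr rfl fun k _ => ?_
      split_ifs
      · ring
      · simp
    have hI : ∀ p k : Fin n, IntegrableOn (fun s : Fin n → ℝ =>
        (if (k : ℕ) < (p : ℕ) then d ((p : ℕ) - (k : ℕ)) else 0) *
          (Real.exp (∑ i, ω (s i)) * g (s k) (s p))) (orderedSimplex n) := fun p k =>
      (integrableOn_orderedSimplex hω hg k p).const_mul _
    simp only [hterm]
    rw [integral_finsetSum _ fun p _ => integrable_finsetSum _ fun k _ => hI p k]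
    refine Finset.sum_congr rfl fun p _ => ?_
    rw [integral_finsetSum _ fun k _ => hI p k]
    refine Finset.sum_congr rfl fun k _ => ?_
    rw [integral_const_mul]
    split_ifs <;> simp
  have hd' : ∀ p k : Fin n, (k : ℕ) < (p : ℕ) → d ((p : ℕ) - (k : ℕ)) =
      σsq * (((p : ℕ) - (k : ℕ) - 1).choose 0 : ℝ) + ∑ j ∈ Finset.range (n - 1),
        (∫ u, (Real.exp u - 1) ^ (j + 2) ∂M) * (((p : ℕ) - (k : ℕ) - 1).choose j : ℝ) := by
    intro p k hkp
    have hp := p.isLt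
    rw [hd _ (by lia) (by lia), integral_exp_mul_eq_sum_choose hint (by lia),
      show n - 2 + 1 = n - 1 by lia]
    simp only [Nat.choose_zero_right, Nat.cast_one, mul_one, mul_comm]
  have hsplit : (∑ p : Fin n, ∑ k : Fin n, if (k : ℕ) < (p : ℕ) then d ((p : ℕ) - (k : ℕ)) *
        ∫ s in orderedSimplex n, Real.exp (∑ i, ω (s i)) * g (s k) (s p) else 0) =
      σsq * (∑ p : Fin n, ∑ k : Fin n, if (k : ℕ) < (p : ℕ) then
        (((p : ℕ) - (k : ℕ) - 1).choose 0 : ℝ) *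
          ∫ s in orderedSimplex n, Real.exp (∑ i, ω (s i)) * g (s k) (s p) else 0) +
      ∑ j ∈ Finset.range (n - 1), (∫ u, (Real.exp u - 1) ^ (j + 2) ∂M) *
        (∑ p : Fin n, ∑ k : Fin n, if (k : ℕ) < (p : ℕ) then
          (((p : ℕ) - (k : ℕ) - 1).choose j : ℝ) *
            ∫ s in orderedSimplex n, Real.exp (∑ i, ω (s i)) * g (s k) (s p) else 0) := by
    simp only [Finset.mul_sum]
    rw [Finset.sum_comm (s := Finset.range (n - 1)), ← Finset.sum_add_distrib]
    refine Finset.sum_congr rfl fun p _ => ?_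
    rw [Finset.sum_comm (s := Finset.range (n - 1)), ← Finset.sum_add_distrib]
    refine Finset.sum_congr rfl fun k _ => ?_
    split_ifs with hkp
    · rw [hd' p k hkp, add_mul, Finset.sum_mul, mul_assoc]
      simp only [mul_assoc]
    · simp
  rw [hlhs, hsplit, sum_choose_mul_setIntegral hω hg hn, mul_add, Finset.mul_sum]
  congr 1
  · have hfac : (n.factorial : ℝ) = n * (n - 1) * ((n - 2).factorial : ℝ) := by
      obtain ⟨m, rfl⟩ := Nat.exists_eq_add_of_le' hn
      rw [Nat.add_sub_cancel, Nat.factorial_succ, Nat.factorial_succ]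
      push_cast
      ring
    have hpos : ((n - 2).factorial : ℝ) ≠ 0 := by positivity
    have h2 : (∫ s in orderedSimplex (0 + 2),
        Real.exp (∑ i, ω (s i)) * g (s 0) (s (Fin.last (0 + 1)))) =
        ∫ s in orderedSimplex 2, Real.exp (ω (s 0) + ω (s 1)) * g (s 0) (s 1) := by
      simp only [Nat.reduceAdd, Fin.sum_univ_two]
      rfl
    rw [h2, hfac, Nat.zero_add]
    field_simp
  · refine Finset.sum_congr rfl fun j hj => ?_
    have hj' := Finset.mem_range.1 hj
    rw [sum_choose_mul_setIntegral hω hg (by lia)]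
    ring
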